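/- For every ε, ε' > 0 and c_1 > 0 sufficiently large there exist c_9 > 0 and C > 0 such that for all x ≥ 3 and 2 ≤ y ≤ x^4 the following holds. Set z = x^4 + y, Q_1 = (log x)^{c_1}, Q_2 = x^{1-ε}, let 𝔐 be the union over q ≤ Q_1 and over a with 1 ≤ a ≤ q, gcd(a,q) = 1, of the intervals [a/q − 1/(qQ_2), a/q + 1/(qQ_2)], and let 𝔪 = [1/Q_2, 1 + 1/Q_2] \ 𝔐. Then Σ_{k ≤ y, κ(k) ≤ y^{1/2 - ε'}} | ∫_{𝔪} ( Σ_{m ≤ x^4 + k} Λ(m) e(αm) ) ( Σ_{n ≤ x} e(−α(n^4 + k)) ) dα |^2 ≤ C x^6 (log x)^{-c_9}. -/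

import Mathlib

open Finset MeasureTheory

/-- `ee θ = e(θ) = exp(2πiθ)`. -/
noncomputable def ee (θ : ℝ) : ℂ := Complex.exp (2 * Real.pi * Complex.I * θ)

/-- The square-full part `κ(n)`: if `n = ℓ^2 * m` with `m` squarefree, then `κ(n) = ℓ^2`. -/
noncomputable def kappa (n : ℕ) : ℕ := ∏ p ∈ n.primeFactors, p ^ (2 * (n.factorization p / 2))

/-- The major arc `𝔐`: the union over `1 ≤ q ≤ Q₁` and `1 ≤ a ≤ q` with `gcd(a,q) = 1` of the
intervals `[a/q - 1/(q Q₂), a/q + 1/(q Q₂)]`. -/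
def majorArc (Q₁ : ℝ) (Q₂ : ℝ) : Set ℝ :=
  ⋃ q ∈ Finset.Icc 1 ⌊Q₁⌋₊, ⋃ a ∈ (Finset.Icc 1 q).filter (fun a => Nat.gcd a q = 1),
    Set.Icc ((a : ℝ) / q - 1 / (q * Q₂)) ((a : ℝ) / q + 1 / (q * Q₂))

lemma le_of_sq_le_sq_aux (a b : ℝ) (hb : 0 ≤ b) (h : a ^ 2 ≤ b ^ 2) : a ≤ b :=
  (le_abs_self a).trans (abs_le_of_sq_le_sq h hb)

lemma ee_add (a b : ℝ) : ee (a + b) = ee a * ee b := by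
  unfold ee
  rw [← Complex.exp_add]; congr 1; push_cast; ring

lemma ee_conj (a : ℝ) : (starRingEnd ℂ) (ee a) = ee (-a) := by
  unfold ee
  rw [← Complex.exp_conj]; congr 1
  simp only [map_mul, Complex.conj_ofReal, Complex.conj_I, map_ofNat]
  push_cast; ring

lemma ee_eq (a : ℝ) : ee a = Complex.exp (((2 * Real.pi * a : ℝ) : ℂ) * Complex.I) := by
  unfold ee; congr 1; push_cast; ring

lemma norm_ee (a : ℝ) : ‖ee a‖ = 1 := by
  rw [ee_eq, Complex.norm_exp_ofReal_mul_I]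

lemma ee_zero : ee 0 = 1 := by simp [ee]

lemma ee_int (n : ℤ) : ee n = 1 := by
  unfold ee
  rw [Complex.exp_eq_one_iff]
  exact ⟨n, by push_cast; ring⟩

lemma ee_cont : Continuous ee := by unfold ee; fun_prop

lemma int_ee (a : ℝ) (n : ℤ) :
    ∫ α in Set.Icc a (a + 1), ee (α * n) = if n = 0 then 1 else 0 := by
  rw [integral_Icc_eq_integral_Ioc, ← intervalIntegral.integral_of_le (by linarith)]
  split_ifs with h
  · subst h; simp [ee_zero]
  · have hc : (2 * Real.pi * Complex.I * n : ℂ) ≠ 0 := by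
      have : (n : ℂ) ≠ 0 := by exact_mod_cast h
      have := Complex.two_pi_I_ne_zero
      positivity
    have := integral_exp_mul_complex (a := a) (b := a + 1) hc
    have h2 : ∀ α : ℝ, ee (α * n) = Complex.exp (2 * Real.pi * Complex.I * n * α) := by
      intro α; unfold ee; congr 1; push_cast; ring
    simp only [h2, this]
    have h3 := ee_add (a * n) n
    rw [ee_int, mul_one, show a * (n : ℝ) + n = (a + 1) * n by ring, h2, h2] at h3
    rw [h3]; simp

lemma parseval (a : ℝ) (M : Finset ℕ) (w : ℕ → ℂ) :
    ∫ α in Set.Icc a (a + 1), ‖∑ m ∈ M, w m * ee (α * m)‖ ^ 2 = ∑ m ∈ M, ‖w m‖ ^ 2 := by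
  have key : ∫ α in Set.Icc a (a + 1), (((‖∑ m ∈ M, w m * ee (α * m)‖ ^ 2 : ℝ)) : ℂ)
      = ∑ m ∈ M, ((‖w m‖ ^ 2 : ℝ) : ℂ) := by
    have h1 : ∀ α : ℝ, (((‖∑ m ∈ M, w m * ee (α * m)‖ ^ 2 : ℝ)) : ℂ) =
        ∑ m ∈ M, ∑ n ∈ M, w m * (starRingEnd ℂ) (w n) * ee (α * ((m - n : ℤ))) := by
      intro α
      push_cast
      rw [← Complex.mul_conj', map_sum, Finset.sum_mul_sum]
      refine Finset.sum_congr rfl fun m _ => Finset.sum_congr rfl fun n _ => ?_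
      rw [map_mul, ee_conj, show α * ((m : ℝ) - n) = α * m + -(α * n) by ring, ee_add]; ring
    simp only [h1]
    have hint : ∀ m n : ℕ, Integrable (fun α : ℝ => w m * (starRingEnd ℂ) (w n) *
        ee (α * ((m - n : ℤ)))) (volume.restrict (Set.Icc a (a + 1))) := by
      intro m n
      apply ContinuousOn.integrableOn_Icc
      apply Continuous.continuousOn
      have := ee_cont
      fun_prop
    rw [integral_finsetSum _ (fun m _ => integrable_finsetSum _ fun n _ => hint m n)]
    refine Finset.sum_congr rfl fun m hm => ?_
    rw [integral_finsetSum _ (fun n _ => hint m n)]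
    simp only [integral_const_mul, int_ee]
    rw [Finset.sum_eq_single m]
    · simp [Complex.mul_conj']
    · intro n _ hn
      have : ((m : ℤ) - n) ≠ 0 := by omega
      simp [this]
    · exact fun h => absurd hm h
  rw [integral_complex_ofReal] at key
  exact_mod_cast key

lemma bessel (a S : ℝ) (E : Set ℝ) (hE : MeasurableSet E)
    (hsub : E ⊆ Set.Icc a (a + 1)) (G : ℝ → ℂ) (hG : Continuous G)
    (hGS : ∀ α ∈ E, ‖G α‖ ≤ S) (K M : Finset ℕ) (w : ℕ → ℂ) :
    ∑ k ∈ K, ‖∑ m ∈ M, w m * ∫ α in E, ee (α * m) * G α * ee (-(α * k))‖ ^ 2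
      ≤ S ^ 2 * ∑ m ∈ M, ‖w m‖ ^ 2 := by
  have hec := ee_cont
  have hI : ∀ f : ℝ → ℂ, Continuous f → IntegrableOn f E := fun f hf =>
    (hf.continuousOn.integrableOn_Icc).mono_set hsub
  have hIR : ∀ f : ℝ → ℝ, Continuous f → IntegrableOn f E := fun f hf =>
    (hf.continuousOn.integrableOn_Icc).mono_set hsub
  set F : ℝ → ℂ := fun α => ∑ m ∈ M, w m * ee (α * m) with hF
  have hFc : Continuous F := by fun_prop
  set c : ℕ → ℂ := fun k => ∑ m ∈ M, w m * ∫ α in E, ee (α * m) * G α * ee (-(α * k)) with hcdef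
  have hc : ∀ k, c k = ∫ α in E, F α * G α * ee (-(α * k)) := by
    intro k
    simp only [hcdef, hF]
    simp only [← integral_const_mul]
    rw [← integral_finsetSum]
    · congr 1; ext α; rw [Finset.sum_mul, Finset.sum_mul]
      exact Finset.sum_congr rfl fun m _ => by ring
    · intro m _
      exact hI _ (by fun_prop)
  set P : ℝ → ℂ := fun α => ∑ k ∈ K, c k * ee (α * k) with hP
  have hPc : Continuous P := by fun_prop
  have h1 : ∫ α in E, F α * G α * (starRingEnd ℂ) (P α) = ((∑ k ∈ K, ‖c k‖ ^ 2 : ℝ) : ℂ) := by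
    simp only [hP, map_sum, Finset.mul_sum]
    rw [integral_finsetSum]
    · push_cast
      refine Finset.sum_congr rfl fun k _ => ?_
      rw [← Complex.mul_conj', mul_comm]
      nth_rewrite 3 [hc k]
      rw [← integral_const_mul]
      congr 1; ext α
      rw [map_mul, ee_conj]; ring
    · intro k _
      apply hI
      have := Complex.continuous_conj
      fun_prop
  have h2 : (∑ k ∈ K, ‖c k‖ ^ 2) = ∫ α in E, (F α * G α * (starRingEnd ℂ) (P α)).re := by
    have := congrArg Complex.re h1
    rw [Complex.ofReal_re] at this
    rw [← this]
    have h3 := integral_re (𝕜 := ℂ) (hI (fun α => F α * G α * (starRingEnd ℂ) (P α)) (by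
      have := Complex.continuous_conj
      fun_prop))
    simpa using h3.symm
  have hrc : Continuous fun α => (F α * G α * (starRingEnd ℂ) (P α)).re := by
    have := Complex.continuous_conj
    have := Complex.continuous_re
    fun_prop
  have h3 : ∫ α in E, 2 * (F α * G α * (starRingEnd ℂ) (P α)).re ≤
      ∫ α in E, (S ^ 2 * ‖F α‖ ^ 2 + ‖P α‖ ^ 2) := by
    apply setIntegral_mono_on (hIR _ (by fun_prop)) (hIR _ (by fun_prop)) hE
    intro α hα
    have e1 := Complex.re_le_norm (F α * G α * (starRingEnd ℂ) (P α))
    rw [norm_mul, norm_mul, RCLike.norm_conj] at e1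
    have e2 := hGS α hα
    have e3 : ‖F α‖ * ‖G α‖ ≤ ‖F α‖ * S := by gcongr
    have e4 : ‖F α‖ * ‖G α‖ * ‖P α‖ ≤ ‖F α‖ * S * ‖P α‖ := by gcongr
    nlinarith [sq_nonneg (S * ‖F α‖ - ‖P α‖)]
  rw [integral_add (hIR _ (by fun_prop)) (hIR _ (by fun_prop)), integral_const_mul,
    integral_const_mul, ← h2] at h3
  have mono : ∀ f : ℝ → ℂ, Continuous f →
      ∫ α in E, ‖f α‖ ^ 2 ≤ ∫ α in Set.Icc a (a + 1), ‖f α‖ ^ 2 := by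
    intro f hf
    apply setIntegral_mono_set
    · apply ContinuousOn.integrableOn_Icc; fun_prop
    · exact Filter.Eventually.of_forall fun α => by positivity
    · exact hsub.eventuallyLE
  have h4 := mono F hFc
  have h5 := mono P hPc
  rw [parseval] at h4 h5
  have h6 : S ^ 2 * ∫ α in E, ‖F α‖ ^ 2 ≤ S ^ 2 * ∑ m ∈ M, ‖w m‖ ^ 2 := by gcongr
  linarith

lemma trunc (c : ℕ → ℕ → ℂ) (w : ℕ → ℂ) (B : ℝ) (hB : 0 ≤ B)
    (h : ∀ K M : Finset ℕ, ∑ k ∈ K, ‖∑ m ∈ M, w m * c k m‖ ^ 2 ≤ B ^ 2 * ∑ m ∈ M, ‖w m‖ ^ 2)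
    (t : ℕ → ℕ) (J : ℕ) : ∀ (s : ℕ) (K : Finset ℕ),
    ∑ k ∈ K, ‖∑ m ∈ (Finset.Ico s (s + 2 ^ J)).filter (fun m => m < t k), w m * c k m‖ ^ 2
      ≤ ((J + 1) * B) ^ 2 * ∑ m ∈ Finset.Ico s (s + 2 ^ J), ‖w m‖ ^ 2 := by
  induction J with
  | zero =>
    intro s K
    have := h K {s}
    simp only [pow_zero, Nat.Ico_succ_singleton, CharP.cast_eq_zero, zero_add, one_mul]
    refine le_trans (Finset.sum_le_sum fun k _ => ?_) this
    rw [Finset.filter_singleton]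
    split_ifs
    · exact le_rfl
    · simp only [Finset.sum_empty, norm_zero, ne_eq, OfNat.ofNat_ne_zero, not_false_eq_true, zero_pow]; positivity
  | succ J ih =>
    intro s K
    set p := s + 2 ^ J with hp
    have hq : s + 2 ^ (J + 1) = p + 2 ^ J := by rw [hp]; ring
    rw [hq]
    have hsplit : Finset.Ico s (p + 2 ^ J) = Finset.Ico s p ∪ Finset.Ico p (p + 2 ^ J) :=
      (Finset.Ico_union_Ico_eq_Ico (Nat.le_add_right _ _) (Nat.le_add_right _ _)).symm
    have hdis : Disjoint (Finset.Ico s p) (Finset.Ico p (p + 2 ^ J)) :=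
      Finset.Ico_disjoint_Ico_consecutive _ _ _
    rw [hsplit, Finset.sum_union hdis]
    set WL := ∑ m ∈ Finset.Ico s p, ‖w m‖ ^ 2
    set WR := ∑ m ∈ Finset.Ico p (p + 2 ^ J), ‖w m‖ ^ 2
    have hWL : 0 ≤ WL := by positivity
    have hWR : 0 ≤ WR := by positivity
    rw [← Finset.sum_filter_add_sum_filter_not K (fun k => t k ≤ p)]
    set A : ℝ := (J + 1) * B with hA
    have hA0 : 0 ≤ A := by positivity
    have b1 : ∑ k ∈ K.filter (fun k => t k ≤ p), ‖∑ m ∈ (Finset.Ico s p ∪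
        Finset.Ico p (p + 2 ^ J)).filter (fun m => m < t k), w m * c k m‖ ^ 2 ≤ A ^ 2 * WL := by
      refine le_trans (le_of_eq ?_) (ih s (K.filter (fun k => t k ≤ p)))
      refine Finset.sum_congr rfl fun k hk => ?_
      have := (Finset.mem_filter.1 hk).2
      congr 3
      ext m; simp only [Finset.mem_filter, Finset.mem_union, Finset.mem_Ico]; omega
    set K2 := K.filter (fun k => ¬ t k ≤ p)
    have b2 : ∑ k ∈ K2, ‖∑ m ∈ (Finset.Ico s p ∪
        Finset.Ico p (p + 2 ^ J)).filter (fun m => m < t k), w m * c k m‖ ^ 2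
        ≤ (A * B + B ^ 2) * WL + (A ^ 2 + A * B) * WR := by
      have i1 := h K2 (Finset.Ico s p)
      have i2 := ih p K2
      set u : ℕ → ℝ := fun k => ‖∑ m ∈ Finset.Ico s p, w m * c k m‖
      set v : ℕ → ℝ := fun k => ‖∑ m ∈ (Finset.Ico p (p + 2 ^ J)).filter (fun m => m < t k),
        w m * c k m‖
      have pt : ∀ k ∈ K2, ‖∑ m ∈ (Finset.Ico s p ∪
          Finset.Ico p (p + 2 ^ J)).filter (fun m => m < t k), w m * c k m‖ ^ 2
          ≤ (u k + v k) ^ 2 := by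
        intro k hk
        have hk2 := (Finset.mem_filter.1 hk).2
        gcongr
        rw [Finset.filter_union, Finset.sum_union (Finset.disjoint_filter_filter hdis),
          Finset.filter_true_of_mem (s := Finset.Ico s p)]
        · exact norm_add_le _ _
        · intro m hm; rw [Finset.mem_Ico] at hm; omega
      have cs := Finset.sum_mul_sq_le_sq_mul_sq K2 u v
      have ex : ∑ k ∈ K2, (u k + v k) ^ 2 = ∑ k ∈ K2, u k ^ 2 + 2 * ∑ k ∈ K2, u k * v k
          + ∑ k ∈ K2, v k ^ 2 := by
        rw [Finset.mul_sum, ← Finset.sum_add_distrib, ← Finset.sum_add_distrib]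
        exact Finset.sum_congr rfl fun k _ => by ring
      have i1' : ∑ k ∈ K2, u k ^ 2 ≤ B ^ 2 * WL := i1
      have i2' : ∑ k ∈ K2, v k ^ 2 ≤ A ^ 2 * WR := i2
      have hx : 2 * ∑ k ∈ K2, u k * v k ≤ A * B * (WL + WR) := by
        have e1 : (∑ k ∈ K2, u k * v k) ^ 2 ≤ (B ^ 2 * WL) * (A ^ 2 * WR) :=
          cs.trans (by gcongr)
        apply le_of_sq_le_sq_aux _ _
        · positivity
        · nlinarith [mul_nonneg (sq_nonneg (A * B)) (sq_nonneg (WL - WR))]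
      refine (Finset.sum_le_sum pt).trans ?_
      rw [ex]; nlinarith
    have : (((J + 1 : ℕ) : ℝ) + 1) * B = A + B := by push_cast; rw [hA]; ring
    rw [this]
    nlinarith [mul_nonneg hA0 hB, mul_nonneg (mul_nonneg hA0 hB) hWL,
      mul_nonneg (mul_nonneg hA0 hB) hWR, mul_nonneg (sq_nonneg B) hWR]

lemma vdc (φ : ℕ → ℝ) (N H : ℕ) (X M : ℝ) (hN : (N : ℝ) ≤ X) (hH : 1 ≤ H) (hHX : (H : ℝ) ≤ X)
    (hM0 : 0 ≤ M)
    (hM : ∀ d, 0 < d → d < H → ‖∑ n ∈ Finset.range (N - d), ee (φ (n + d) - φ n)‖ ≤ M) :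
    ‖∑ n ∈ Finset.range N, ee (φ n)‖ ^ 2 ≤ 2 * X * (X * (1 / H) + M) := by
  set g : ℕ → ℕ → ℂ := fun j h => if h ≤ j ∧ j - h < N then ee (φ (j - h)) else 0 with hg
  set S := ∑ n ∈ Finset.range N, ee (φ n) with hS
  have corr0 : ∀ h < H, ∑ j ∈ Finset.range (N + H), g j h = S := by
    intro h hh
    symm
    apply Finset.sum_of_injOn (fun n => n + h)
    · intro a _ b _ hab; simpa using hab
    · intro n hn; simp at hn ⊢; omega
    · intro j _ hj
      simp only [hg]
      rw [if_neg]
      rintro ⟨h1, h2⟩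
      exact hj ⟨j - h, by simpa using h2, by simp; omega⟩
    · intro n hn
      simp at hn
      simp [hg, hn]
  have corr : ∀ h h', h ≤ h' → h' < H → ∑ j ∈ Finset.range (N + H), g j h *
      (starRingEnd ℂ) (g j h') =
      ∑ n ∈ Finset.range (N - (h' - h)), ee (φ (n + (h' - h)) - φ n) := by
    intro h h' hh hh'
    symm
    apply Finset.sum_of_injOn (fun n => n + h')
    · intro a _ b _ hab; simpa using hab
    · intro n hn; simp at hn ⊢; omega
    · intro j _ hj
      by_cases h1 : h' ≤ j ∧ j - h' < N
      · by_cases h2 : h ≤ j ∧ j - h < N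
        · exact absurd ⟨j - h', by simp; omega, by simp; omega⟩ hj
        · simp [hg, h2]
      · simp [hg, h1]
    · intro n hn
      simp at hn
      have e1 : h ≤ n + h' ∧ n + h' - h < N := by omega
      have e2 : n < N := by omega
      have e3 : n + h' - h = n + (h' - h) := by omega
      simp only [hg]
      rw [if_pos e1, if_pos ⟨by omega, by omega⟩, ee_conj, ← ee_add, e3, Nat.add_sub_cancel]
      rfl
  have hHr : (1 : ℝ) ≤ H := by exact_mod_cast hH
  have bd : ∀ h ∈ Finset.range H, ∀ h' ∈ Finset.range H,
      ‖∑ j ∈ Finset.range (N + H), g j h * (starRingEnd ℂ) (g j h')‖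
        ≤ (if h = h' then (N : ℝ) else 0) + M := by
    intro h hh h' hh'
    rw [Finset.mem_range] at hh hh'
    rcases lt_trichotomy h h' with hlt | heq | hgt
    · rw [corr h h' hlt.le hh', if_neg hlt.ne, zero_add]
      exact hM _ (by omega) (by omega)
    · subst heq
      rw [corr h h le_rfl hh, if_pos rfl]
      have : ‖∑ n ∈ Finset.range (N - (h - h)), ee (φ (n + (h - h)) - φ n)‖ ≤ N := by
        refine (norm_sum_le _ _).trans ?_
        simp [norm_ee]
      linarith
    · have : ∑ j ∈ Finset.range (N + H), g j h * (starRingEnd ℂ) (g j h') =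
          (starRingEnd ℂ) (∑ j ∈ Finset.range (N + H), g j h' * (starRingEnd ℂ) (g j h)) := by
        rw [map_sum]
        refine Finset.sum_congr rfl fun j _ => ?_
        rw [map_mul, Complex.conj_conj, mul_comm]
      rw [this, RCLike.norm_conj, corr h' h hgt.le hh, if_neg hgt.ne', zero_add]
      exact hM _ (by omega) (by omega)
  have main : (H : ℝ) ^ 2 * ‖S‖ ^ 2 ≤ (N + H) * (H * N + H ^ 2 * M) := by
    have e1 : (H : ℂ) * S = ∑ j ∈ Finset.range (N + H), ∑ h ∈ Finset.range H, g j h := by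
      rw [Finset.sum_comm, Finset.sum_congr rfl fun h hh => corr0 h (Finset.mem_range.1 hh)]
      simp
    have e2 : ((H : ℝ) * ‖S‖) ≤ ∑ j ∈ Finset.range (N + H), ‖∑ h ∈ Finset.range H, g j h‖ := by
      have := norm_sum_le (Finset.range (N + H)) (fun j => ∑ h ∈ Finset.range H, g j h)
      rw [← e1, norm_mul] at this
      simpa using this
    have e3 := sq_sum_le_card_mul_sum_sq (s := Finset.range (N + H))
      (f := fun j => ‖∑ h ∈ Finset.range H, g j h‖)
    have e4 : ((∑ j ∈ Finset.range (N + H), ‖∑ h ∈ Finset.range H, g j h‖ ^ 2 : ℝ) : ℂ) =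
        ∑ h ∈ Finset.range H, ∑ h' ∈ Finset.range H, ∑ j ∈ Finset.range (N + H),
          g j h * (starRingEnd ℂ) (g j h') := by
      push_cast
      simp only [← Complex.mul_conj', map_sum, Finset.sum_mul_sum]
      rw [Finset.sum_comm]
      refine Finset.sum_congr rfl fun h _ => ?_
      rw [Finset.sum_comm]
    have e5 : ∑ j ∈ Finset.range (N + H), ‖∑ h ∈ Finset.range H, g j h‖ ^ 2
        ≤ H * N + H ^ 2 * M := by
      have h1 := congrArg norm e4
      rw [Complex.norm_real, Real.norm_of_nonneg (by positivity)] at h1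
      rw [h1]
      refine (norm_sum_le _ _).trans ?_
      calc _ ≤ ∑ h ∈ Finset.range H, ∑ h' ∈ Finset.range H,
            ((if h = h' then (N : ℝ) else 0) + M) := by
            refine Finset.sum_le_sum fun h hh => (norm_sum_le _ _).trans ?_
            exact Finset.sum_le_sum fun h' hh' => bd h hh h' hh'
        _ = ∑ h ∈ Finset.range H, ((N : ℝ) + H * M) := by
            refine Finset.sum_congr rfl fun h hh => ?_
            rw [Finset.sum_add_distrib, Finset.sum_ite_eq, if_pos hh]; simp
        _ = _ := by simp; ring
    calc (H : ℝ) ^ 2 * ‖S‖ ^ 2 = (H * ‖S‖) ^ 2 := by ring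
      _ ≤ (∑ j ∈ Finset.range (N + H), ‖∑ h ∈ Finset.range H, g j h‖) ^ 2 := by gcongr
      _ ≤ _ := e3
      _ ≤ _ := by
        rw [Finset.card_range]; push_cast; gcongr
  have hpos : (0 : ℝ) < H ^ 2 := by positivity
  have hN0 : (0 : ℝ) ≤ N := by positivity
  have fin : ((N : ℝ) + H) * (H * N + H ^ 2 * M) ≤ (2 * X) * (H * X + H ^ 2 * M) := by
    apply mul_le_mul (by linarith) (by gcongr) (by positivity) (by linarith)
  have : (H : ℝ) ^ 2 * (2 * X * (X * (1 / H) + M)) = (2 * X) * (H * X + H ^ 2 * M) := by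
    field_simp
  exact le_of_mul_le_mul_left (by rw [this]; exact main.trans fin) hpos

lemma geo (θ c δ : ℝ) (hδ : 0 < δ) (h : δ ≤ |θ - round θ|) (M : ℕ) :
    ‖∑ n ∈ Finset.range M, ee (θ * n + c)‖ ≤ 1 / (2 * δ) := by
  have hlow : 4 * δ ≤ ‖ee θ - 1‖ := by
    have e1 : ee θ = ee (θ - round θ) := by
      have := ee_add (θ - round θ) (round θ)
      rw [ee_int, mul_one, sub_add_cancel] at this
      exact this
    set t := θ - round θ
    rw [e1, ee_eq, mul_comm _ Complex.I, Complex.norm_exp_I_mul_ofReal_sub_one, norm_mul, Real.norm_eq_abs,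
      Real.norm_eq_abs, abs_two, show 2 * Real.pi * t / 2 = Real.pi * t by ring]
    have ht : |t| ≤ 1 / 2 := abs_sub_round θ
    have hp := Real.pi_pos
    have e2 : |Real.pi * t| = Real.pi * |t| := by rw [abs_mul, abs_of_pos hp]
    have := Real.mul_abs_le_abs_sin (x := Real.pi * t) (by rw [e2]; nlinarith)
    rw [e2] at this
    have e3 : 2 / Real.pi * (Real.pi * |t|) = 2 * |t| := by field_simp
    linarith
  have hpow : ∀ n : ℕ, ee (θ * n) = ee θ ^ n := by
    intro n
    induction n with
    | zero => simp [ee_zero]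
    | succ n ih => rw [pow_succ, ← ih, ← ee_add]; congr 1; push_cast; ring
  have hne : ee θ ≠ 1 := by
    intro h0; rw [h0] at hlow; simp at hlow; linarith
  simp only [ee_add, ← Finset.sum_mul, hpow]
  rw [geom_sum_eq hne, norm_mul, norm_ee, mul_one, norm_div]
  have hnum : ‖ee θ ^ M - 1‖ ≤ 2 := by
    refine (norm_sub_le _ _).trans ?_
    rw [norm_pow, norm_ee]; norm_num
  rw [div_le_div_iff₀ (by linarith) (by linarith)]
  nlinarith

lemma weyl (α X r : ℝ) (N H : ℕ) (hN : (N : ℝ) ≤ X) (hH : 1 ≤ H) (hHX : (H : ℝ) ≤ X)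
    (hr : 0 < r) (hr1 : r ≤ 1) (hHr : 1 / (H : ℝ) ≤ r ^ 8)
    (hlin : ∀ d1 d2 d3 : ℕ, 0 < d1 → d1 < H → 0 < d2 → d2 < H → 0 < d3 → d3 < H →
      ∀ (c : ℝ) (M : ℕ), ‖∑ n ∈ Finset.range M, ee (-(24 * α * (d1 * d2 * d3)) * n + c)‖
        ≤ X * r ^ 8) :
    ‖∑ n ∈ Finset.range N, ee (-(α * ((n + 1 : ℕ) : ℝ) ^ 4))‖ ≤ 3 * X * r := by
  have hX : 0 ≤ X := le_trans (by positivity) hN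
  have step : ∀ (φ : ℕ → ℝ) (L : ℕ) (M : ℝ), (L : ℝ) ≤ X → 0 ≤ M →
      (∀ d, 0 < d → d < H → ‖∑ n ∈ Finset.range (L - d), ee (φ (n + d) - φ n)‖ ≤ M) →
      ‖∑ n ∈ Finset.range L, ee (φ n)‖ ^ 2 ≤ 2 * X * (X * r ^ 8 + M) := by
    intro φ L M hL hM0 hM
    refine (vdc φ L H X M hL hH hHX hM0 hM).trans ?_
    gcongr
  have hsub : ∀ (L d : ℕ), (L : ℝ) ≤ X → ((L - d : ℕ) : ℝ) ≤ X := by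
    intro L d hL
    refine le_trans ?_ hL
    exact_mod_cast Nat.sub_le _ _
  have p8 : r ^ 8 ≤ r ^ 4 := pow_le_pow_of_le_one hr.le hr1 (by norm_num)
  have p82 : r ^ 8 ≤ r ^ 2 := pow_le_pow_of_le_one hr.le hr1 (by norm_num)
  apply le_of_sq_le_sq_aux _ _ (by positivity)
  refine (step _ N (3 * X * r ^ 2) hN (by positivity) fun d1 h1 h1' => ?_).trans ?_
  swap
  · nlinarith [mul_nonneg (mul_nonneg hX hX) (sub_nonneg.2 p82), mul_nonneg hX hX, sq_nonneg (X * r)]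
  apply le_of_sq_le_sq_aux _ _ (by positivity)
  refine (step (fun n => _) (N - d1) (2 * X * r ^ 4) (hsub _ _ hN) (by positivity)
    fun d2 h2 h2' => ?_).trans ?_
  swap
  · nlinarith [mul_nonneg (mul_nonneg hX hX) (sub_nonneg.2 p8), mul_nonneg hX hX, sq_nonneg (X * r ^ 2)]
  apply le_of_sq_le_sq_aux _ _ (by positivity)
  refine (step (fun n => _) (N - d1 - d2) (X * r ^ 8) (hsub _ _ (hsub _ _ hN)) (by positivity)
    fun d3 h3 h3' => ?_).trans ?_
  swap
  · exact le_of_eq (by ring)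
  refine le_trans (le_of_eq ?_) (hlin d1 d2 d3 h1 h1' h2 h2' h3 h3'
    (-(α * (24 * (d1 * d2 * d3) + 12 * (d1 * d2 * d3) * (d1 + d2 + d3)))) (N - d1 - d2 - d3))
  congr 1
  refine Finset.sum_congr rfl fun n _ => ?_
  congr 1
  push_cast
  ring

lemma dist_lemma (α Q₂ : ℝ) (r : ℚ) (D : ℕ) (hD : 0 < D) (hDq : 24 * D < r.den)
    (hQ : 48 * (D : ℝ) ≤ Q₂) (hr : |α - r| ≤ 1 / (r.den * Q₂)) (j : ℤ) :
    1 / (2 * (r.den : ℝ)) ≤ |-(24 * α * D) - j| := by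
  have hq : (0 : ℝ) < r.den := by exact_mod_cast r.den_pos
  have hDr : (0 : ℝ) < D := by exact_mod_cast hD
  have hQ0 : 0 < Q₂ := by linarith
  have hne : 24 * (D : ℤ) * r.num + j * r.den ≠ 0 := by
    intro h0
    have h1 : (r.den : ℤ) ∣ 24 * D * r.num := ⟨-j, by linarith⟩
    have hcop : IsCoprime (r.den : ℤ) r.num := by
      rw [Int.isCoprime_iff_gcd_eq_one, Int.gcd_comm]
      simpa [Int.gcd, Nat.Coprime] using r.reduced
    have h2 := hcop.dvd_of_dvd_mul_right h1
    have h3 : r.den ∣ 24 * D := by exact_mod_cast h2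
    have := Nat.le_of_dvd (by omega) h3
    omega
  have h1 : (1 : ℝ) ≤ |((24 * (D : ℤ) * r.num + j * r.den : ℤ) : ℝ)| := by
    exact_mod_cast Int.one_le_abs hne
  have hrr : (r : ℝ) = r.num / r.den := Rat.cast_def r
  have h2 : ((24 * (D : ℤ) * r.num + j * r.den : ℤ) : ℝ) =
      r.den * (-(-(24 * α * D) - j) - 24 * D * (α - r)) := by
    rw [hrr]; push_cast; field_simp; ring
  rw [h2, abs_mul, abs_of_pos hq] at h1
  have h3 : |(-(-(24 * α * D) - j) - 24 * D * (α - r))| ≤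
      |-(24 * α * D) - j| + 24 * D * |α - r| := by
    refine (abs_sub _ _).trans ?_
    rw [abs_neg, abs_mul (24 * (D : ℝ)), abs_of_pos (by positivity : (0:ℝ) < 24 * D)]
  have h4 : 24 * D * |α - r| ≤ 1 / (2 * (r.den : ℝ)) := by
    calc 24 * D * |α - r| ≤ 24 * D * (1 / (r.den * Q₂)) := by gcongr
      _ ≤ _ := by
        rw [mul_one_div, div_le_div_iff₀ (by positivity) (by positivity)]
        nlinarith
  have h5 : 1 ≤ r.den * (|-(24 * α * D) - j| + 1 / (2 * (r.den : ℝ))) :=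
    h1.trans (by gcongr; linarith)
  have h6 : r.den * (|-(24 * α * D) - j| + 1 / (2 * (r.den : ℝ))) =
    r.den * |-(24 * α * D) - j| + 1 / 2 := by field_simp
  rw [div_le_iff₀ (by positivity)]
  linarith

lemma sum_shift (x α : ℝ) : ∑ n ∈ Finset.Icc 1 ⌊x⌋₊, ee (-(α * (n : ℝ) ^ 4)) =
    ∑ n ∈ Finset.range ⌊x⌋₊, ee (-(α * ((n + 1 : ℕ) : ℝ) ^ 4)) := by
  rw [Finset.range_eq_Ico, Finset.sum_Ico_add' (fun n : ℕ => ee (-(α * (n : ℝ) ^ 4))) 0 ⌊x⌋₊ 1]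
  rfl

/-- large `x` -/
lemma minor_large (ε c₁ x α : ℝ) (hε : 0 < ε) (hc : 73 ≤ c₁) (hx : 3 ≤ x)
    (hL : 400 ≤ Real.log x) (h1 : Real.log x ^ 24 ≤ x ^ ε)
    (h2 : Real.log x ^ c₁ + 1 ≤ x ^ (1 - ε))
    (hα : α ∈ Set.Icc (1 / x ^ ((1:ℝ) - ε)) (1 + 1 / x ^ ((1:ℝ) - ε)) \
              majorArc (Real.log x ^ c₁) (x ^ ((1:ℝ) - ε))) :
    ‖∑ n ∈ Finset.Icc 1 ⌊x⌋₊, ee (-(α * (n : ℝ) ^ 4))‖ ≤ 3 * x * (1 / Real.log x ^ 3) := by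
  set L := Real.log x with hLdef
  set Q₂ := x ^ (1 - ε) with hQ
  have hx0 : 0 < x := by linarith
  have hQx : Q₂ ≤ x := by
    calc Q₂ ≤ x ^ (1 : ℝ) := Real.rpow_le_rpow_of_exponent_le (by linarith) (by linarith)
      _ = x := Real.rpow_one x
  have h73 : L ^ 73 ≤ L ^ c₁ := by
    rw [← Real.rpow_natCast]
    exact Real.rpow_le_rpow_of_exponent_le (by linarith) (by exact_mod_cast hc)
  have h72 : 400 * L ^ 72 ≤ L ^ 73 := by
    rw [pow_succ' L 72]; exact mul_le_mul_of_nonneg_right hL (by positivity)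
  have hL1 : 1 ≤ L := by linarith
  have hQ1pos : 1 ≤ L ^ c₁ := Real.one_le_rpow hL1 (by linarith)
  have hQ2 : 2 ≤ Q₂ := by linarith
  set H := ⌈L ^ 24⌉₊ with hHdef
  have hL24 : 1 ≤ L ^ 24 := one_le_pow₀ hL1
  have hHlow : L ^ 24 ≤ H := Nat.le_ceil _
  have hHup : (H : ℝ) ≤ 2 * L ^ 24 := by
    have := (Nat.ceil_lt_add_one (by positivity : 0 ≤ L ^ 24)).le
    linarith
  have hH1 : 1 ≤ H := by
    have : (1 : ℝ) ≤ H := hL24.trans hHlow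
    exact_mod_cast this
  -- approximate
  have hfl : 0 < ⌊Q₂⌋₊ := Nat.floor_pos.2 (by linarith)
  obtain ⟨r, hr, hrd⟩ := Real.exists_rat_abs_sub_le_and_den_le α hfl
  have hq : (0 : ℝ) < r.den := by exact_mod_cast r.den_pos
  have hq1 : (1 : ℝ) ≤ r.den := by exact_mod_cast r.den_pos
  have hrdQ : (r.den : ℝ) ≤ Q₂ :=
    le_trans (by exact_mod_cast hrd) (Nat.floor_le (by linarith))
  have hlt : |α - r| < 1 / (r.den * Q₂) := by
    refine lt_of_le_of_lt hr ?_
    have := Nat.lt_floor_add_one Q₂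
    rw [mul_comm]
    gcongr
  have hrr : (r : ℝ) = r.num / r.den := Rat.cast_def r
  have hden : L ^ c₁ < r.den := by
    by_contra hcon
    push Not at hcon
    obtain ⟨⟨ha, hb⟩, hmaj⟩ := hα
    apply hmaj
    have habs := abs_lt.1 hlt
    have i1 : 1 / (r.den * Q₂) ≤ 1 / Q₂ := by
      apply one_div_le_one_div_of_le (by linarith); nlinarith
    have rpos : (0 : ℝ) < r := by linarith
    have rpos' : 0 < r := by exact_mod_cast rpos
    have numpos : 0 < r.num := Rat.num_pos.2 rpos'
    have numle : r.num ≤ r.den := by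
      by_contra hc2
      push Not at hc2
      have hc3 : ((r.den : ℝ) + 1) ≤ r.num := by exact_mod_cast hc2
      have hc4 : 1 + 1 / (r.den : ℝ) ≤ r := by
        rw [hrr, le_div_iff₀ hq]; field_simp; linarith
      have hc5 : 1 / (r.den : ℝ) < 1 / Q₂ + 1 / (r.den * Q₂) := by linarith
      have hc6 : 1 / Q₂ + 1 / (r.den * Q₂) = (r.den + 1) / (r.den * Q₂) := by
        field_simp
      rw [hc6, div_lt_div_iff₀ hq (by positivity)] at hc5
      nlinarith
    unfold majorArc
    simp only [Set.mem_iUnion]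
    obtain ⟨a, haN⟩ := Int.eq_ofNat_of_zero_le numpos.le
    refine ⟨r.den, Finset.mem_Icc.2 ⟨r.den_pos, Nat.le_floor hcon⟩, a, ?_, ?_⟩
    · rw [Finset.mem_filter, Finset.mem_Icc]
      refine ⟨⟨by omega, by omega⟩, ?_⟩
      have := r.reduced
      rw [haN] at this
      simpa [Nat.Coprime] using this
    · have : (a : ℝ) / r.den = r := by rw [hrr, haN]; simp
      rw [this]
      exact ⟨by linarith, by linarith⟩
  rw [sum_shift]
  have hr8 : (1 / L ^ 3) ^ 8 = 1 / L ^ 24 := by rw [div_pow, one_pow, ← pow_mul]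
  refine weyl α x (1 / L ^ 3) ⌊x⌋₊ H (Nat.floor_le hx0.le) hH1 ?_ (by positivity) ?_ ?_ ?_
  · have : L ^ 24 ≤ L ^ 72 := pow_le_pow_right₀ hL1 (by norm_num)
    linarith
  · rw [div_le_one (by positivity)]; exact one_le_pow₀ hL1
  · rw [hr8]; gcongr
  · intro d1 d2 d3 a1 b1 a2 b2 a3 b3 c M
    have hD : ((d1 * d2 * d3 : ℕ) : ℝ) ≤ 8 * L ^ 72 := by
      have : d1 * d2 * d3 ≤ H * H * H := by gcongr
      calc ((d1 * d2 * d3 : ℕ) : ℝ) ≤ ((H * H * H : ℕ) : ℝ) := by exact_mod_cast this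
        _ = (H : ℝ) ^ 3 := by push_cast; ring
        _ ≤ (2 * L ^ 24) ^ 3 := by gcongr
        _ = _ := by ring
    have hL72 : 1 ≤ L ^ 72 := one_le_pow₀ hL1
    have hd := dist_lemma α Q₂ r (d1 * d2 * d3) (by positivity) (by
      have : (24 * (d1 * d2 * d3 : ℕ) : ℝ) < r.den := by linarith
      exact_mod_cast this) (by linarith) hlt.le (round (-(24 * α * ((d1 * d2 * d3 : ℕ) : ℝ))))
    have hg := geo _ c _ (by positivity) hd M
    push_cast at hg
    refine hg.trans ?_
    rw [hr8]
    have hxx : x = Q₂ * x ^ ε := by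
      rw [hQ, ← Real.rpow_add hx0]; simp
    have : Q₂ ≤ x * (1 / L ^ 24) := by
      rw [mul_one_div, le_div_iff₀ (by positivity)]
      calc Q₂ * L ^ 24 ≤ Q₂ * x ^ ε := by gcongr
        _ = x := hxx.symm
    refine le_trans (le_of_eq ?_) (hrdQ.trans this)
    field_simp

lemma minor (ε c₁ : ℝ) (hε : 0 < ε) (hc : 73 ≤ c₁) : ∃ C > (0 : ℝ), ∀ x α : ℝ, 3 ≤ x →
    α ∈ Set.Icc (1 / x ^ ((1:ℝ) - ε)) (1 + 1 / x ^ ((1:ℝ) - ε)) \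
              majorArc (Real.log x ^ c₁) (x ^ ((1:ℝ) - ε)) →
    ‖∑ n ∈ Finset.Icc 1 ⌊x⌋₊, ee (-(α * (n : ℝ) ^ 4))‖ ≤ C * x * (1 / Real.log x ^ 3) := by
  have hlog1 : ∀ x : ℝ, 3 ≤ x → 1 ≤ Real.log x := by
    intro x hx
    rw [Real.le_log_iff_exp_le (by linarith)]
    have := Real.exp_one_lt_d9
    linarith
  rcases le_or_gt 1 ε with h1 | h1
  · refine ⟨1, one_pos, fun x α hx hα => ?_⟩
    exfalso
    obtain ⟨⟨ha, hb⟩, hmaj⟩ := hα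
    apply hmaj
    have hQ : x ^ (1 - ε) ≤ 1 := Real.rpow_le_one_of_one_le_of_nonpos (by linarith) (by linarith)
    have hQ0 : 0 < x ^ (1 - ε) := Real.rpow_pos_of_pos (by linarith) _
    have hQ1 : 1 ≤ 1 / x ^ (1 - ε) := by rwa [le_div_iff₀ hQ0, one_mul]
    unfold majorArc
    simp only [Set.mem_iUnion]
    refine ⟨1, Finset.mem_Icc.2 ⟨le_rfl, Nat.le_floor ?_⟩, 1, by simp, ?_⟩
    · simpa using Real.one_le_rpow (hlog1 x hx) (by linarith : 0 ≤ c₁)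
    · simp only [Nat.cast_one, div_one, one_mul]
      exact ⟨by linarith, by linarith⟩
  · have ev1 : ∀ᶠ x : ℝ in Filter.atTop, 400 ≤ Real.log x :=
      Real.tendsto_log_atTop.eventually_ge_atTop 400
    have ev2 : ∀ᶠ x : ℝ in Filter.atTop, Real.log x ^ 24 ≤ x ^ ε := by
      have := (isLittleO_log_rpow_rpow_atTop 24 hε).bound one_pos
      filter_upwards [this, ev1, Filter.eventually_ge_atTop 3] with x hx h400 h3
      rw [Real.norm_of_nonneg (by positivity), Real.norm_of_nonneg (by positivity), one_mul] at hx
      exact_mod_cast hx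
    have ev3 : ∀ᶠ x : ℝ in Filter.atTop, Real.log x ^ c₁ + 1 ≤ x ^ (1 - ε) := by
      have := (isLittleO_log_rpow_rpow_atTop c₁ (sub_pos.2 h1)).bound (half_pos one_pos)
      filter_upwards [this, ev1, Filter.eventually_ge_atTop 3] with x hx h400 h3
      rw [Real.norm_of_nonneg (by positivity), Real.norm_of_nonneg (by positivity)] at hx
      have := Real.one_le_rpow (by linarith : 1 ≤ Real.log x) (by linarith : 0 ≤ c₁)
      linarith
    obtain ⟨X0, hX0⟩ := Filter.eventually_atTop.1 (ev1.and (ev2.and ev3))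
    refine ⟨3 + |Real.log X0| ^ 3, by positivity, fun x α hx hα => ?_⟩
    have hl := hlog1 x hx
    rcases le_or_gt X0 x with hxx | hxx
    · obtain ⟨e1, e2, e3⟩ := hX0 x hxx
      refine (minor_large ε c₁ x α hε hc hx e1 e2 e3 hα).trans ?_
      gcongr
      have : 0 ≤ |Real.log X0| ^ 3 := by positivity
      linarith
    · have t1 : ‖∑ n ∈ Finset.Icc 1 ⌊x⌋₊, ee (-(α * (n : ℝ) ^ 4))‖ ≤ x := by
        refine (norm_sum_le _ _).trans ?_
        simp only [norm_ee, Finset.sum_const, Nat.card_Icc, Nat.add_sub_cancel, nsmul_eq_mul, mul_one]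
        exact Nat.floor_le (by linarith)
      refine t1.trans ?_
      rw [mul_one_div, le_div_iff₀ (by positivity), mul_comm]
      gcongr
      have : Real.log x ≤ |Real.log X0| :=
        (Real.log_le_log (by linarith) hxx.le).trans (le_abs_self _)
      have : Real.log x ^ 3 ≤ |Real.log X0| ^ 3 := by gcongr
      linarith

lemma measurable_major (Q₁ Q₂ : ℝ) : MeasurableSet (majorArc Q₁ Q₂) := by
  unfold majorArc
  exact Finset.measurableSet_biUnion _ fun q _ =>
    Finset.measurableSet_biUnion _ fun a _ => measurableSet_Icc

theorem stmt17 (ε ε' : ℝ) (hε : 0 < ε) (hε' : 0 < ε') :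
    ∃ c₀ > (0:ℝ), ∀ c₁ : ℝ, c₀ ≤ c₁ → ∃ c₉ > (0:ℝ), ∃ C > 0, ∀ x y : ℝ,
      3 ≤ x → 2 ≤ y → y ≤ x ^ 4 →
      ∑ k ∈ (Finset.Icc 1 ⌊y⌋₊).filter (fun k => (kappa k : ℝ) ≤ y ^ ((1 : ℝ) / 2 - ε')),
        ‖∫ α in (Set.Icc (1 / x ^ ((1:ℝ) - ε)) (1 + 1 / x ^ ((1:ℝ) - ε)) \
              majorArc (Real.log x ^ c₁) (x ^ ((1:ℝ) - ε))),
            ((∑ m ∈ Finset.Icc 1 ⌊x ^ 4 + (k : ℝ)⌋₊,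
                (ArithmeticFunction.vonMangoldt m : ℂ) * ee (α * m)) *
              ∑ n ∈ Finset.Icc 1 ⌊x⌋₊, ee (-(α * ((n : ℝ) ^ 4 + (k : ℝ)))))‖ ^ 2
        ≤ C * x ^ 6 * Real.log x ^ (-c₉) := by
  refine ⟨73, by norm_num, fun c₁ hc => ?_⟩
  obtain ⟨C, hC, hmin⟩ := minor ε c₁ hε hc
  refine ⟨2, by norm_num, 14400 * C ^ 2, by positivity, fun x y hx hy hyx => ?_⟩
  have hec := ee_cont
  set L := Real.log x with hL
  have hL1 : 1 ≤ L := by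
    rw [hL, Real.le_log_iff_exp_le (by linarith)]
    have := Real.exp_one_lt_d9
    linarith
  set a := 1 / x ^ ((1:ℝ) - ε) with ha
  set E := Set.Icc a (1 + a) \ majorArc (L ^ c₁) (x ^ ((1:ℝ) - ε)) with hE
  have hEm : MeasurableSet E := measurableSet_Icc.diff (measurable_major _ _)
  have hEs : E ⊆ Set.Icc a (a + 1) := by
    rw [add_comm a 1]; exact Set.sdiff_subset
  set G : ℝ → ℂ := fun α => ∑ n ∈ Finset.Icc 1 ⌊x⌋₊, ee (-(α * (n : ℝ) ^ 4)) with hG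
  have hGc : Continuous G := by fun_prop
  set S := C * x * (1 / L ^ 3) with hS
  have hS0 : 0 ≤ S := by positivity
  have hGS : ∀ α ∈ E, ‖G α‖ ≤ S := fun α hα => hmin x α hx hα
  set w : ℕ → ℂ := fun m => (ArithmeticFunction.vonMangoldt m : ℂ) with hw
  set c : ℕ → ℕ → ℂ := fun k m => ∫ α in E, ee (α * m) * G α * ee (-(α * k)) with hcdef
  set J := Nat.log 2 ⌊2 * x ^ 4⌋₊ + 1 with hJ
  have hx4 : 1 ≤ x ^ 4 := one_le_pow₀ (by linarith)
  have hf0 : ⌊2 * x ^ 4⌋₊ ≠ 0 := (Nat.floor_pos.2 (by linarith)).ne'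
  have hJ1 : ⌊2 * x ^ 4⌋₊ < 2 ^ J := Nat.lt_pow_succ_log_self (by norm_num) _
  have hJ2 : ((2 ^ J : ℕ) : ℝ) ≤ 4 * x ^ 4 := by
    have h1 : 2 ^ Nat.log 2 ⌊2 * x ^ 4⌋₊ ≤ ⌊2 * x ^ 4⌋₊ := Nat.pow_log_le_self 2 hf0
    have h2 : ((2 ^ Nat.log 2 ⌊2 * x ^ 4⌋₊ : ℕ) : ℝ) ≤ 2 * x ^ 4 :=
      le_trans (by exact_mod_cast h1) (Nat.floor_le (by positivity))
    rw [hJ, pow_succ]; push_cast at h2 ⊢; linarith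
  have hlogb : Real.log (4 * x ^ 4) ≤ 6 * L := by
    rw [Real.log_mul (by norm_num) (by positivity), Real.log_pow]
    have : Real.log 4 ≤ 2 * L := by
      rw [show (4 : ℝ) = 2 ^ 2 by norm_num, Real.log_pow]
      have : Real.log 2 ≤ L := Real.log_le_log (by norm_num) (by linarith)
      push_cast; linarith
    push_cast; linarith
  have hJ3 : (J : ℝ) + 1 ≤ 10 * L := by
    have h1 : Real.log ((2 ^ J : ℕ) : ℝ) ≤ Real.log (4 * x ^ 4) :=
      Real.log_le_log (by positivity) hJ2
    push_cast at h1
    rw [Real.log_pow] at h1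
    have h2 := Real.log_two_gt_d9
    have h3 : (0 : ℝ) ≤ J := by positivity
    nlinarith
  have hT := trunc c w S hS0 (fun K M => bessel a S E hEm hEs G hGc hGS K M w)
    (fun k => ⌊x ^ 4 + (k : ℝ)⌋₊ + 1) J 1
    ((Finset.Icc 1 ⌊y⌋₊).filter (fun k => (kappa k : ℝ) ≤ y ^ ((1 : ℝ) / 2 - ε')))
  have hW : ∑ m ∈ Finset.Ico 1 (1 + 2 ^ J), ‖w m‖ ^ 2 ≤ 4 * x ^ 4 * (6 * L) ^ 2 := by
    calc ∑ m ∈ Finset.Ico 1 (1 + 2 ^ J), ‖w m‖ ^ 2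
        ≤ ∑ m ∈ Finset.Ico 1 (1 + 2 ^ J), (6 * L) ^ 2 := by
          refine Finset.sum_le_sum fun m hm => ?_
          rw [Finset.mem_Ico] at hm
          have h1 : (m : ℝ) ≤ 4 * x ^ 4 := by
            refine le_trans ?_ hJ2
            exact_mod_cast (by omega : m ≤ 2 ^ J)
          have h2 : (0 : ℝ) < m := by exact_mod_cast (by omega : 0 < m)
          have h3 : ‖w m‖ ≤ 6 * L := by
            simp only [hw]
            rw [Complex.norm_real, Real.norm_of_nonneg ArithmeticFunction.vonMangoldt_nonneg]
            exact ArithmeticFunction.vonMangoldt_le_log.trans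
              ((Real.log_le_log h2 h1).trans hlogb)
          gcongr
      _ = ((2 ^ J : ℕ) : ℝ) * (6 * L) ^ 2 := by
          rw [Finset.sum_const, Nat.card_Ico, nsmul_eq_mul, Nat.add_sub_cancel_left]
      _ ≤ _ := by gcongr
  have hfin : (((J : ℝ) + 1) * S) ^ 2 * ∑ m ∈ Finset.Ico 1 (1 + 2 ^ J), ‖w m‖ ^ 2
      ≤ 14400 * C ^ 2 * x ^ 6 * L ^ (-(2 : ℝ)) := by
    calc _ ≤ (10 * L * S) ^ 2 * (4 * x ^ 4 * (6 * L) ^ 2) := by gcongr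
      _ = _ := by
        rw [Real.rpow_neg (by linarith), Real.rpow_ofNat, hS]
        field_simp
        ring
  refine le_trans (le_of_eq ?_) (hT.trans hfin)
  refine Finset.sum_congr rfl fun k hk => ?_
  have hk1 : (k : ℝ) ≤ x ^ 4 := by
    have := (Finset.mem_Icc.1 (Finset.mem_filter.1 hk).1).2
    refine le_trans ?_ hyx
    exact (Nat.le_floor_iff (by linarith)).1 this
  have hkf : ⌊x ^ 4 + (k : ℝ)⌋₊ ≤ ⌊2 * x ^ 4⌋₊ := Nat.floor_mono (by linarith)
  have hset : (Finset.Ico 1 (1 + 2 ^ J)).filter (fun m => m < ⌊x ^ 4 + (k : ℝ)⌋₊ + 1) =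
      Finset.Icc 1 ⌊x ^ 4 + (k : ℝ)⌋₊ := by
    ext m; simp only [Finset.mem_filter, Finset.mem_Ico, Finset.mem_Icc]; omega
  rw [hset]
  congr 2
  simp only [hcdef, ← integral_const_mul]
  rw [← integral_finsetSum]
  · congr 1
    ext α
    have hGk : ∑ n ∈ Finset.Icc 1 ⌊x⌋₊, ee (-(α * ((n : ℝ) ^ 4 + (k : ℝ)))) =
        G α * ee (-(α * k)) := by
      rw [hG, Finset.sum_mul]
      refine Finset.sum_congr rfl fun n _ => ?_
      rw [← ee_add]; congr 1; ring
    rw [hGk, Finset.sum_mul]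
    exact Finset.sum_congr rfl fun m _ => by simp only [hw]; ring
  · intro m _
    exact (Continuous.continuousOn (by fun_prop)).integrableOn_Icc.mono_set hEs
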